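/- arXiv:2603.05790 — 4 statements merged into one kernel-verified Lean document; each statement's English description precedes it below -/
import Mathlib

section
/- Let (M,g) be a Riemannian manifold and ψ ∈ Aut(TM) a g-Codazzi map. Define η(X,Y) := g(ψ^{-1}X, Y) and let η_a(X,Y) := (η(X,Y) − η(Y,X))/2 be its antisymmetric part. Then the 2-form η_a is closed: dη_a = 0. -/
universe u v

variable {C : Type u} {V : Type v} [CommRing C] [AddCommGroup V] [Module C V] [LieRing V]

/-- Abstract axioms of the Riemannian-manifold setting: `C` plays the role of the ring
`C^∞(M)` of smooth functions, `V` the `C^∞(M)`-module of vector fields with its Lie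
bracket, `D X f` is the action of the vector field `X` on the function `f` (derivation),
`g` is the Riemannian metric and `cn` its Levi-Civita connection. -/
structure RiemannSetting (D : V → C → C) (g : V →ₗ[C] V →ₗ[C] C)
    (cn : V → V → V) : Prop where
  D_add : ∀ (X : V) (f₁ f₂ : C), D X (f₁ + f₂) = D X f₁ + D X f₂
  D_mul : ∀ (X : V) (f₁ f₂ : C), D X (f₁ * f₂) = D X f₁ * f₂ + f₁ * D X f₂
  D_addX : ∀ (X Y : V) (f : C), D (X + Y) f = D X f + D Y f
  D_smulX : ∀ (f : C) (X : V) (k : C), D (f • X) k = f * D X k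
  D_bracket : ∀ (X Y : V) (f : C), D ⁅X, Y⁆ f = D X (D Y f) - D Y (D X f)
  g_symm : ∀ X Y : V, g X Y = g Y X
  g_nondeg : ∀ X : V, (∀ Y : V, g X Y = 0) → X = 0
  cn_addX : ∀ X Y Z : V, cn (X + Y) Z = cn X Z + cn Y Z
  cn_smulX : ∀ (f : C) (X Y : V), cn (f • X) Y = f • cn X Y
  cn_addY : ∀ X Y Z : V, cn X (Y + Z) = cn X Y + cn X Z
  cn_leibniz : ∀ (X : V) (f : C) (Y : V), cn X (f • Y) = D X f • Y + f • cn X Y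
  torsion_free : ∀ X Y : V, cn X Y - cn Y X = ⁅X, Y⁆
  metric_compat : ∀ X Y Z : V, D X (g Y Z) = g (cn X Y) Z + g Y (cn X Z)

/-- `ψ` is a `g`-Codazzi map: `(∇_X ψ⁻¹)Y = (∇_Y ψ⁻¹)X`. -/
def IsCodazziMap (cn : V → V → V) (ψ : V ≃ₗ[C] V) : Prop :=
  ∀ X Y : V, cn X (ψ.symm Y) - ψ.symm (cn X Y) = cn Y (ψ.symm X) - ψ.symm (cn Y X)

/-- The twisted metric `g^ψ := g(ψ⁻¹·, ψ⁻¹·)`. -/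
def twistedMetric (g : V →ₗ[C] V →ₗ[C] C) (ψ : V ≃ₗ[C] V) : V →ₗ[C] V →ₗ[C] C :=
  g.compl₁₂ ψ.symm.toLinearMap ψ.symm.toLinearMap

/-- The curvature endomorphism `R(X,Y)Z` of a connection `cn`. -/
def curv (cn : V → V → V) (X Y Z : V) : V :=
  cn X (cn Y Z) - cn Y (cn X Z) - cn ⁅X, Y⁆ Z


/-- The exterior derivative of a 2-form `β` expressed via the action `D` of vector fields
on functions and the Lie bracket. -/
def extDer2 (D : V → C → C) (β : V → V → C) (X Y Z : V) : C :=
  D X (β Y Z) - D Y (β X Z) + D Z (β X Y)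
    - β ⁅X, Y⁆ Z + β ⁅X, Z⁆ Y - β ⁅Y, Z⁆ X

/-- For a `g`-Codazzi map `ψ`, the antisymmetric part
`η_a(X,Y) := (η(X,Y) − η(Y,X))/2` of `η(X,Y) := g(ψ⁻¹X, Y)` is a closed 2-form. -/
theorem codazzi_antisymmetric_part_closed
    [Algebra ℝ C]
    (D : V → C → C) (g : V →ₗ[C] V →ₗ[C] C) (cn : V → V → V)
    (hg : RiemannSetting D g cn)
    (hDconst : ∀ (X : V) (r : ℝ), D X (algebraMap ℝ C r) = 0)
    (ψ : V ≃ₗ[C] V) (hψ : IsCodazziMap cn ψ) :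
    ∀ X Y Z : V,
      extDer2 D
        (fun A B : V => ((2:ℝ)⁻¹) • (g (ψ.symm A) B - g (ψ.symm B) A)) X Y Z = 0 := by
  intro X Y Z
  have hsub : ∀ (W : V) (a b : C), D W (a - b) = D W a - D W b := by
    intro W a b
    have h := hg.D_add W (a - b) b
    rw [sub_add_cancel] at h
    rw [h, add_sub_cancel_right]
  have hsm : ∀ (W : V) (r : ℝ) (a : C), D W (r • a) = algebraMap ℝ C r * D W a := by
    intro W r a
    rw [Algebra.smul_def, hg.D_mul, hDconst, zero_mul, zero_add]
  have key : ∀ A B E : V,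
      g (cn A (ψ.symm B)) E - g (ψ.symm (cn A B)) E
        = g (cn B (ψ.symm A)) E - g (ψ.symm (cn B A)) E := by
    intro A B E
    have h := congrArg (fun v => g v E) (hψ A B)
    simpa only [map_sub, LinearMap.sub_apply] using h
  unfold extDer2
  simp only [hsm, hsub, hg.metric_compat]
  simp only [← hg.torsion_free, map_sub, LinearMap.sub_apply, Algebra.smul_def]
  linear_combination (algebraMap ℝ C (2:ℝ)⁻¹) * (key X Y Z + key Y Z X + key Z X Y)
end

section
/- Let (M,g,J,ω) be an almost Hermitian manifold and ψ ∈ Aut(TM) a g-Codazzi map. Then ρ^ψ(X,Y) := ψ^{-1}[ψX, ψY] − [X,Y] satisfies ρ^ψ(X,Y) = ∇^g_{ψX}Y − ∇^g_{ψY}X − [X,Y] for all vector fields X,Y. -/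
universe u v

variable {C : Type u} {V : Type v} [CommRing C] [AddCommGroup V] [Module C V] [LieRing V]

/-- On an almost Hermitian manifold `(M,g,J,ω)`, if `ψ` is a
`g`-Codazzi map then `ρ^ψ(X,Y) := ψ⁻¹[ψX,ψY] − [X,Y]` equals
`∇^g_{ψX}Y − ∇^g_{ψY}X − [X,Y]`. -/
theorem rho_twist_of_codazzi
    (D : V → C → C) (g : V →ₗ[C] V →ₗ[C] C) (cn : V → V → V)
    (hg : RiemannSetting D g cn)
    (J : V →ₗ[C] V)
    (hJ2 : ∀ X : V, J (J X) = -X)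
    (hJg : ∀ X Y : V, g (J X) (J Y) = g X Y)
    (ψ : V ≃ₗ[C] V) (hψ : IsCodazziMap cn ψ) :
    ∀ X Y : V,
      ψ.symm ⁅ψ X, ψ Y⁆ - ⁅X, Y⁆ = cn (ψ X) Y - cn (ψ Y) X - ⁅X, Y⁆ := by
  intro X Y
  have h := hψ (ψ X) (ψ Y)
  simp only [LinearEquiv.symm_apply_apply] at h
  rw [← hg.torsion_free (ψ X) (ψ Y), map_sub]
  have h2 : ψ.symm (cn (ψ X) (ψ Y)) - ψ.symm (cn (ψ Y) (ψ X)) = cn (ψ X) Y - cn (ψ Y) X := by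
    rw [sub_eq_sub_iff_add_eq_add] at h ⊢
    rw [add_comm, ← h, add_comm]
  rw [h2]
end

section
/- Let (M,g,J,ω) be a nearly Kähler manifold and ψ ∈ Aut(TM) a g-Codazzi map that is self-adjoint with respect to g. Then J^ψ := ψ∘J∘ψ^{-1} is integrable (i.e., N_{J^ψ} = 0) if and only if (∇^g_Z J)∘𝒦 = 𝒦∘(∇^g_Z J) for all vector fields Z, where 𝒦 := Jψ + ψJ. -/
universe u v

variable {C : Type u} {V : Type v} [CommRing C] [AddCommGroup V] [Module C V] [LieRing V]

/-- The Nijenhuis tensor `N_J(X,Y) := J[JX,Y] + J[X,JY] + [X,Y] - [JX,JY]`. -/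
def nijenhuis (J : V → V) (X Y : V) : V :=
  J ⁅J X, Y⁆ + J ⁅X, J Y⁆ + ⁅X, Y⁆ - ⁅J X, J Y⁆

/-- Let `(M,g,J,ω)` be nearly Kähler (`(∇_X J)Y = −(∇_Y J)X`, with
`ω = g(J·,·)`) and `ψ` a self-adjoint `g`-Codazzi map.  Then `J^ψ := ψ∘J∘ψ⁻¹` is
integrable (its Nijenhuis tensor vanishes) iff `(∇_Z J) ∘ 𝒦 = 𝒦 ∘ (∇_Z J)` for all `Z`,
where `𝒦 := Jψ + ψJ`. -/
theorem twisted_integrability_nearly_kaehler_selfadjoint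
    (D : V → C → C) (g : V →ₗ[C] V →ₗ[C] C) (cn : V → V → V)
    (hg : RiemannSetting D g cn)
    (J : V →ₗ[C] V)
    (hJ2 : ∀ X : V, J (J X) = -X)
    (hJg : ∀ X Y : V, g (J X) (J Y) = g X Y)
    (hNK : ∀ X Y : V, cn X (J Y) - J (cn X Y) = -(cn Y (J X) - J (cn Y X)))
    (ψ : V ≃ₗ[C] V) (hψ : IsCodazziMap cn ψ)
    (hsa : ∀ X Y : V, g (ψ X) Y = g X (ψ Y)) :
    (∀ X Y : V, nijenhuis (fun v => ψ (J (ψ.symm v))) X Y = 0)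
      ↔ (∀ Z X : V,
          cn Z (J (J (ψ X) + ψ (J X))) - J (cn Z (J (ψ X) + ψ (J X)))
            = J (ψ (cn Z (J X) - J (cn Z X))) + ψ (J (cn Z (J X) - J (cn Z X)))) := by
  have cn_zero : ∀ X, cn X 0 = 0 := fun X => by
    have h := hg.cn_addY X 0 0
    simpa using h
  have cn_neg : ∀ X Y, cn X (-Y) = -cn X Y := fun X Y => by
    have h := hg.cn_addY X Y (-Y)
    rw [add_neg_cancel, cn_zero] at h
    exact eq_neg_of_add_eq_zero_right h.symm
  have D_zero : ∀ X, D X 0 = 0 := fun X => by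
    have h := hg.D_add X 0 0
    simpa using h
  have J_skew : ∀ X Y, g (J X) Y = -g X (J Y) := fun X Y => by
    rw [← hJg (J X) Y, hJ2]; simp
  obtain ⟨A, hA⟩ : ∃ A : V → V → V, ∀ X Y, A X Y = cn X (J Y) - J (cn X Y) :=
    ⟨_, fun _ _ => rfl⟩
  have A_anti : ∀ X Y, A X Y = -A Y X := fun X Y => by rw [hA, hA]; exact hNK X Y
  have A_addX : ∀ X Y Z, A (X + Y) Z = A X Z + A Y Z := fun X Y Z => by
    simp only [hA, hg.cn_addX, map_add]; abel
  have A_J : ∀ X Y, A X (J Y) = -J (A X Y) := fun X Y => by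
    simp only [hA, hJ2, cn_neg, map_sub]; abel
  have A_JX : ∀ X Y, A (J X) Y = -J (A X Y) := fun X Y => by
    rw [A_anti, A_J, A_anti X Y, map_neg]
  have A_skew : ∀ X Y Z, g (A X Y) Z = -g Y (A X Z) := fun X Y Z => by
    have h1 := hg.metric_compat X (J Y) Z
    have h2 := hg.metric_compat X Y (J Z)
    have h3 := hg.D_add X (g (J Y) Z) (g Y (J Z))
    rw [J_skew Y Z, neg_add_cancel, D_zero, ← J_skew Y Z, h1, h2] at h3
    have h4 := J_skew (cn X Y) Z
    have h5 := J_skew Y (cn X Z)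
    simp only [hA, map_sub, LinearMap.sub_apply]
    linear_combination -h3 - h4 - h5
  obtain ⟨K, hK⟩ : ∃ K : V → V, ∀ X, K X = J (ψ X) + ψ (J X) := ⟨_, fun _ => rfl⟩
  have K_skew : ∀ X Y, g (K X) Y = -g X (K Y) := fun X Y => by
    simp only [hK, map_add, LinearMap.add_apply, J_skew, hsa]; ring
  have hbr : ∀ a b, ⁅ψ a, ψ b⁆ = ψ (cn (ψ a) b - cn (ψ b) a) := fun a b => by
    have h := hψ (ψ a) (ψ b)
    simp only [LinearEquiv.symm_apply_apply] at h
    rw [← hg.torsion_free]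
    apply ψ.symm.injective
    rw [LinearEquiv.symm_apply_apply, map_sub]
    have h' := sub_eq_zero.2 h
    rw [← sub_eq_zero, ← neg_eq_zero, ← h']
    abel
  have hN : ∀ x y, nijenhuis (fun v => ψ (J (ψ.symm v))) (ψ x) (ψ y)
      = ψ (A y (K x) - A x (K y)) := fun x y => by
    have e : A y (K x) - A x (K y)
        = -A (ψ (J x)) y + A (ψ (J y)) x - J (A (ψ y) x) + J (A (ψ x) y) := by
      rw [A_anti y, A_anti x, hK, hK, A_addX, A_addX, A_JX, A_JX]; abel
    rw [e]
    simp only [nijenhuis, LinearEquiv.symm_apply_apply, hbr]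
    simp only [hA, map_add, map_sub, map_neg, hJ2]
    abel
  have key : ∀ x y z, g (A y (K x) - A x (K y)) z = -g (A z (K x) - K (A z x)) y := by
    intro x y z
    have e1 : g (A y (K x)) z = -g (A z (K x)) y := by
      rw [A_skew y, A_anti y z, A_skew z, map_neg]
    have e2 : g (A x (K y)) z = -g (K (A z x)) y := by
      rw [K_skew, A_skew, A_anti z x, hg.g_symm (K y)]
      simp only [map_neg, LinearMap.neg_apply, neg_neg]
    simp only [map_sub, LinearMap.sub_apply, e1, e2]; ring
  have l1 : (∀ X Y : V, nijenhuis (fun v => ψ (J (ψ.symm v))) X Y = 0)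
      ↔ ∀ x y, A y (K x) - A x (K y) = 0 := by
    constructor
    · intro h x y
      have := hN x y
      rw [h] at this
      exact (ψ.map_eq_zero_iff).1 this.symm
    · intro h X Y
      have := hN (ψ.symm X) (ψ.symm Y)
      rw [h, map_zero] at this
      simpa only [LinearEquiv.apply_symm_apply] using this
  have l2 : (∀ x y, A y (K x) - A x (K y) = 0) ↔ ∀ z x, A z (K x) = K (A z x) := by
    constructor
    · intro h z x
      apply sub_eq_zero.1
      apply hg.g_nondeg
      intro y
      have := key x y z
      rw [h, map_zero, LinearMap.zero_apply] at this
      exact neg_eq_zero.1 this.symm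
    · intro h x y
      apply hg.g_nondeg
      intro z
      rw [key, h]; simp
  rw [l1, l2]
  simp only [hA, hK]
end

section
/- Let (M,g,J,ω) be a strictly nearly Kähler manifold (nearly Kähler with J non-integrable). Then there is no g-Codazzi map ψ ∈ Aut(TM) that anti-commutes with J, i.e., satisfying ψJ = −Jψ. -/
universe u v

variable {C : Type u} {V : Type v} [CommRing C] [AddCommGroup V] [Module C V] [LieRing V]

/-- If an additive map `φ`, injective, anticommutes with `J` and is Codazzi, and `J` is nearly
Kähler for `cn`, then `4 (∇_X J) Y = 0`. -/
theorem core_four_smul {W : Type*} [AddCommGroup W] (cn : W → W → W) (J φ : W →+ W)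
    (cn_neg : ∀ X Y : W, cn X (-Y) = -cn X Y)
    (hJ2 : ∀ X : W, J (J X) = -X)
    (hNK : ∀ X Y : W, cn X (J Y) - J (cn X Y) = -(cn Y (J X) - J (cn Y X)))
    (hinj : ∀ X : W, φ X = 0 → X = 0)
    (hC : ∀ X Y : W, cn X (φ Y) - φ (cn X Y) = cn Y (φ X) - φ (cn Y X))
    (hanti : ∀ X : W, φ (J X) = -J (φ X)) (X Y : W) :
    (4 : ℤ) • (cn X (J Y) - J (cn X Y)) = 0 ∧
      J ((cn (J X) Y - cn Y (J X))) + J (cn X (J Y) - cn (J Y) X) + (cn X Y - cn Y X)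
        - (cn (J X) (J Y) - cn (J Y) (J X)) = 0 := by
  obtain ⟨a, ha⟩ : ∃ a : W → W → W, ∀ X Y, a X Y = cn X (J Y) - J (cn X Y) := ⟨_, fun _ _ => rfl⟩
  obtain ⟨s, hs⟩ : ∃ s : W → W → W, ∀ X Y, s X Y = cn X (φ Y) - φ (cn X Y) := ⟨_, fun _ _ => rfl⟩
  have a_anti : ∀ X Y, a X Y = -a Y X := by
    intro X Y; rw [ha, ha]; exact hNK X Y
  have s_symm : ∀ X Y, s X Y = s Y X := by
    intro X Y; rw [hs, hs]; exact hC X Y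
  have aJ : ∀ X Y, a X (J Y) = -J (a X Y) := by
    intro X Y; simp only [ha, hJ2, cn_neg, map_sub]; abel
  have aJ' : ∀ X Y, a (J X) Y = -J (a X Y) := by
    intro X Y; rw [a_anti, aJ, a_anti Y X]; simp
  have h1 : ∀ X Y, s X (J Y) = -J (s X Y) - φ (a X Y) - a X (φ Y) := by
    intro X Y; simp only [ha, hs, hanti, cn_neg, map_sub]; abel
  have h2 : ∀ X Y, s (J X) (J Y) = -s X Y + J (φ (a Y X)) + J (a Y (φ X))
      - J (φ (a X Y)) + J (a X (φ Y)) := by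
    intro X Y
    rw [h1, s_symm (J X) Y, h1 Y X, s_symm Y X, aJ', aJ']
    simp only [map_sub, map_neg, hJ2, hanti]; abel
  have key : ∀ X Y, (4 : ℤ) • a X Y = 0 := by
    intro X Y
    apply hinj
    have e := s_symm (J X) (J Y)
    rw [h2, h2, s_symm Y X, a_anti Y X] at e
    simp only [map_neg] at e
    have e2 : (4 : ℤ) • J (φ (a X Y)) = 0 := by
      rw [← sub_eq_zero] at e
      rw [← neg_eq_zero, ← e]; abel
    have e3 := congrArg J e2
    rw [map_zsmul, hJ2, map_zero, smul_neg, neg_eq_zero] at e3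
    rw [map_zsmul, e3]
  refine ⟨by rw [← ha]; exact key X Y, ?_⟩
  have e1 : ∀ X Y, cn X (J Y) = a X Y + J (cn X Y) := by
    intro X Y; rw [ha]; abel
  have e4 := congrArg J (key X Y)
  rw [map_zsmul, map_zero] at e4
  rw [e1 (J X) Y, e1 (J Y) X, e1 X Y, e1 Y X, aJ', aJ', a_anti Y X]
  simp only [map_sub, map_add, map_neg, hJ2]
  rw [← e4]; abel

/-- On a strictly nearly Kähler manifold (nearly Kähler with `J`
non-integrable, i.e. `N_J ≠ 0`), no `g`-Codazzi map anti-commutes with `J`. -/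
theorem no_anticommuting_codazzi_map_strictly_nearly_kaehler
    (D : V → C → C) (g : V →ₗ[C] V →ₗ[C] C) (cn : V → V → V)
    (hg : RiemannSetting D g cn)
    (J : V →ₗ[C] V)
    (hJ2 : ∀ X : V, J (J X) = -X)
    (hJg : ∀ X Y : V, g (J X) (J Y) = g X Y)
    (hNK : ∀ X Y : V, cn X (J Y) - J (cn X Y) = -(cn Y (J X) - J (cn Y X)))
    (hstrict : ¬ (∀ X Y : V, nijenhuis (fun v => J v) X Y = 0)) :
    ¬ ∃ ψ : V ≃ₗ[C] V, IsCodazziMap cn ψ ∧ ∀ X : V, ψ (J X) = - J (ψ X) := by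
  rintro ⟨ψ, hC, hanti⟩
  apply hstrict
  intro X Y
  have cn_zero : ∀ X : V, cn X 0 = 0 := by
    intro X
    have h := hg.cn_addY X 0 0
    rw [add_zero] at h
    exact left_eq_add.mp h
  have cn_neg : ∀ X Y : V, cn X (-Y) = -cn X Y := by
    intro X Y
    have h := hg.cn_addY X Y (-Y)
    rw [add_neg_cancel, cn_zero] at h
    exact eq_neg_of_add_eq_zero_right h.symm
  have hφ : ∀ X : V, ψ.symm (J X) = -J (ψ.symm X) := by
    intro X
    apply ψ.injective
    rw [ψ.apply_symm_apply, map_neg, hanti, ψ.apply_symm_apply, neg_neg]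
  have h := (core_four_smul cn J.toAddMonoidHom ψ.symm.toLinearMap.toAddMonoidHom cn_neg hJ2 hNK
    (fun X hX => (LinearEquiv.map_eq_zero_iff ψ.symm).mp hX) hC hφ X Y).2
  unfold nijenhuis
  simp only [← hg.torsion_free]
  exact h
end
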